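/- For every w ∈ ℝ² with w ≠ (0,0) there exist C > 0 and λ₀ > 0 such that for all 0 < λ < λ₀ and every ξ ∈ 𝒪_τ(R_λ(w)), one has |𝒫(ξ) − 𝒫(w)| ≤ C·λ. -/

import Mathlib

open Filter Topology

noncomputable def Fe (lam : ℝ) : Equiv.Perm (ℤ × ℤ) where
  toFun p := (⌊lam * p.1⌋ - p.2, p.1)
  invFun p := (p.2, ⌊lam * p.2⌋ - p.1)
  left_inv p := by simp
  right_inv p := by simp

noncomputable def pt (lam : ℝ) (p : ℤ × ℤ) : ℝ × ℝ := (lam * p.1, lam * p.2)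

noncomputable def wfield (q : ℝ × ℝ) : ℤ × ℤ := (2*⌊q.2⌋+1, -(2*⌊q.1⌋+1))

def vcond (lam : ℝ) (p : ℤ × ℤ) : Prop :=
  pt lam ((Fe lam ^ 4) p) - pt lam p
    = lam • ((((wfield (pt lam p)).1 : ℝ)), (((wfield (pt lam p)).2 : ℝ)))

/-- Euclidean distance from `z ∈ ℝ²` to the symmetry line `{(t,t)}`. -/
noncomputable def dline (z : ℝ × ℝ) : ℝ := |z.1 - z.2| / Real.sqrt 2

/-- The return domain `X`, described by lattice indices. -/
noncomputable def Xset (lam : ℝ) : Set (ℤ × ℤ) :=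
  {p | 0 ≤ p.1 ∧ 0 ≤ p.2 ∧
    dline (pt lam p) ≤ dline (pt lam ((Fe lam ^ 4) p)) ∧
    dline (pt lam p) < dline (pt lam ((Fe lam ^ (-4 : ℤ)) p))}

/-- The forward transit time `τ(z) = min{k ≥ 1 : F_λᵏ(z) ∈ X}`. -/
noncomputable def tauPlus (lam : ℝ) (p : ℤ × ℤ) : ℕ :=
  sInf {k : ℕ | 1 ≤ k ∧ (Fe lam ^ (k : ℤ)) p ∈ Xset lam}

/-- The backward transit time `τ₋(z) = min{k ≥ 0 : F_λ⁻ᵏ(z) ∈ X}`. -/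
noncomputable def tauMinus (lam : ℝ) (p : ℤ × ℤ) : ℕ :=
  sInf {k : ℕ | (Fe lam ^ (-(k : ℤ))) p ∈ Xset lam}

/-- The return orbit `𝒪_τ(z) = {F_λᵏ(z) : −τ₋(z) ≤ k ≤ τ(z)}` (lattice indices). -/
noncomputable def retOrbit (lam : ℝ) (p : ℤ × ℤ) : Set (ℤ × ℤ) :=
  {q | ∃ k : ℤ, -(tauMinus lam p : ℤ) ≤ k ∧ k ≤ (tauPlus lam p : ℤ) ∧ q = (Fe lam ^ k) p}

/-- The rescaled round-off `R_λ(w) = λ(⌊w₁/λ⌋, ⌊w₂/λ⌋)`, as a lattice index. -/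
noncomputable def Rlam (lam : ℝ) (w : ℝ × ℝ) : ℤ × ℤ := (⌊w.1 / lam⌋, ⌊w.2 / lam⌋)

noncomputable def mu2 (w : ℝ × ℝ) (lam : ℝ) : ℝ :=
  ({q | q ∈ retOrbit lam (Rlam lam w) ∧ vcond lam q} : Set (ℤ × ℤ)).ncard /
    (retOrbit lam (Rlam lam w)).ncard

/-- The piecewise-affine function `P(x) = ⌊x⌋² + (2⌊x⌋+1)(x − ⌊x⌋)`. -/
noncomputable def Pfun (x : ℝ) : ℝ := (⌊x⌋ : ℝ)^2 + (2*(⌊x⌋ : ℝ)+1)*(x - ⌊x⌋)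

/-- The piecewise-affine Hamiltonian `𝒫(x,y) = P(x) + P(y)`. -/
noncomputable def ham (z : ℝ × ℝ) : ℝ := Pfun z.1 + Pfun z.2

/-! ### Abstract integer dynamics -/

/-- Abstract properties of the scalar orbit `x (n+2) = g (n+1) - x n`. -/
structure Osc (x g : ℕ → ℤ) (M D : ℤ) (N : ℕ) : Prop where
  recur : ∀ n, x (n+2) + x n = g (n+1)
  pos : ∀ n, 0 ≤ x n → 0 ≤ g n
  neg : ∀ n, x n < 0 → g n ≤ -1
  bdg : ∀ n, n ≤ N → -M ≤ g n ∧ g n ≤ M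
  big : ∀ n, n ≤ N → D ≤ |x n| ∨ D ≤ |x (n+1)|

/-- One step of the fourth iterate, for a pair `(y, v)`. -/
structure RotStep (M y v y' v' : ℤ) : Prop where
  h1 : M < v → y' + 1 ≤ y
  h2 : v < -M → y + 1 ≤ y'
  h3 : 2 * M < y → v + 1 ≤ v'
  h4 : y < -(2 * M) → v' + 1 ≤ v
  h5 : y' - y ≤ 2 * M ∧ y - y' ≤ 2 * M
  h6 : v' - v ≤ 2 * M ∧ v - v' ≤ 2 * M

lemma RotStep.symm {M y v y' v' : ℤ} (h : RotStep M y v y' v') :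
    RotStep M (-y) (-v) (-y') (-v') := by
  obtain ⟨h1, h2, h3, h4, h5, h6⟩ := h
  constructor <;> omega

lemma Osc.step {x g : ℕ → ℤ} {M D : ℤ} {N : ℕ} (h : Osc x g M D N) (n : ℕ) (hn : n + 5 ≤ N) :
    RotStep M (x n) (x (n+1)) (x (n+4)) (x (n+5)) := by
  have r0 := h.recur n
  have r1 := h.recur (n+1)
  have r2 := h.recur (n+2)
  have r3 := h.recur (n+3)
  have p1 := h.pos (n+1)
  have p2 := h.pos (n+2)
  have p3 := h.pos (n+3)
  have p4 := h.pos (n+4)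
  have n1 := h.neg (n+1)
  have n2 := h.neg (n+2)
  have n3 := h.neg (n+3)
  have n4 := h.neg (n+4)
  have b1 := h.bdg (n+1) (by omega)
  have b2 := h.bdg (n+2) (by omega)
  have b3 := h.bdg (n+3) (by omega)
  have b4 := h.bdg (n+4) (by omega)
  simp only [add_assoc] at *
  norm_num at *
  constructor <;> omega

lemma incr_of_step (f : ℕ → ℤ) (a b : ℕ) (hab : a < b)
    (h : ∀ i, a ≤ i → i < b → f i + 1 ≤ f (i+1)) : f a < f b := by
  induction b with
  | zero => omega
  | succ b ih =>
    have h1 := h b (by omega) (by omega)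
    rcases Nat.lt_or_ge a b with h2 | h2
    · have := ih h2 (fun i hi hi' => h i hi (by omega))
      omega
    · have : a = b := by omega
      subst this; omega

lemma decr_of_step (f : ℕ → ℤ) (a b : ℕ) (hab : a < b)
    (h : ∀ i, a ≤ i → i < b → f (i+1) + 1 ≤ f i) : f b < f a := by
  have := incr_of_step (fun i => - f i) a b hab (fun i h1 h2 => by have := h i h1 h2; omega)
  omega

lemma dist_of_step (f : ℕ → ℤ) (K : ℤ) (b : ℕ)
    (h : ∀ i, i < b → f (i+1) - f i ≤ K ∧ f i - f (i+1) ≤ K) :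
    f b - f 0 ≤ K * b ∧ f 0 - f b ≤ K * b := by
  induction b with
  | zero => simp
  | succ b ih =>
    have h1 := h b (by omega)
    have := ih (fun i hi => h i (by omega))
    push_cast
    constructor <;> linarith

/-- The monotonicity property needed for counting. -/
def SepProp (M : ℤ) (y v : ℕ → ℤ) (j k : ℕ) : Prop :=
  (M < v j → M < v k → y k < y j) ∧ (v j < -M → v k < -M → y j < y k) ∧
    ((-M ≤ v j ∧ v j ≤ M) → (-M ≤ v k ∧ v k ≤ M) → v j ≠ v k)

lemma sep_aux (M D : ℤ) (y v : ℕ → ℤ) (L : ℕ) (hM : 1 ≤ M)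
    (hs : ∀ j, j < L → RotStep M (y j) (v j) (y (j+1)) (v (j+1)))
    (hL : 2 * M * L + 2 * M < D) (hD : D ≤ y 0 ∨ D ≤ v 0)
    (j k : ℕ) (hjk : j < k) (hk : k ≤ L) : SepProp M y v j k := by
  have ML : ∀ i : ℕ, i ≤ L → 2 * M * i ≤ 2 * M * L := fun i hi => by
    have : (i : ℤ) ≤ L := by exact_mod_cast hi
    nlinarith
  rcases hD with hD | hD
  · have hy : ∀ i, i ≤ L → 2 * M < y i := fun i hi => by
      have := (dist_of_step y (2*M) i (fun m hm => (hs m (by omega)).h5)).2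
      have := ML i hi
      linarith
    have hv : ∀ a b, a < b → b ≤ L → v a < v b := fun a b hab hb =>
      incr_of_step v a b hab (fun i h1 h2 => (hs i (by omega)).h3 (hy i (by omega)))
    refine ⟨fun h1 h2 => ?_, fun h1 h2 => ?_, fun h1 h2 => (hv j k hjk hk).ne⟩
    · refine decr_of_step y j k hjk (fun i hi hi' => (hs i (by omega)).h1 ?_)
      rcases eq_or_lt_of_le hi with e | e
      · rw [← e]; exact h1
      · have := hv j i e (by omega); omega
    · refine incr_of_step y j k hjk (fun i hi hi' => (hs i (by omega)).h2 ?_)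
      have := hv i k hi' hk; omega
  · have hv : ∀ i, i ≤ L → 2 * M < v i := fun i hi => by
      have := (dist_of_step v (2*M) i (fun m hm => (hs m (by omega)).h6)).2
      have := ML i hi
      linarith
    have a1 := hv j (by omega)
    have a2 := hv k hk
    refine ⟨fun h1 h2 => ?_, fun h1 h2 => by omega, fun h1 h2 => by omega⟩
    exact decr_of_step y j k hjk (fun i hi hi' => (hs i (by omega)).h1 (by
      have := hv i (by omega); omega))

lemma sep (M D : ℤ) (y v : ℕ → ℤ) (L : ℕ) (hM : 1 ≤ M)
    (hs : ∀ j, j < L → RotStep M (y j) (v j) (y (j+1)) (v (j+1)))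
    (hL : 2 * M * L + 2 * M < D) (hD : D ≤ |y 0| ∨ D ≤ |v 0|)
    (j k : ℕ) (hjk : j < k) (hk : k ≤ L) : SepProp M y v j k := by
  by_cases h : D ≤ y 0 ∨ D ≤ v 0
  · exact sep_aux M D y v L hM hs hL h j k hjk hk
  · have h' : D ≤ - y 0 ∨ D ≤ - v 0 := by
      rcases hD with h1 | h1 <;> rcases abs_cases (y 0) with h2 | h2 <;>
        rcases abs_cases (v 0) with h3 | h3 <;> omega
    have := sep_aux M D (fun i => - y i) (fun i => - v i) L hM (fun j hj => (hs j hj).symm) hL h'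
      j k hjk hk
    unfold SepProp at *
    simp only at this
    obtain ⟨s1, s2, s3⟩ := this
    refine ⟨fun a b => ?_, fun a b => ?_, fun a b c => ?_⟩
    · have := s2 (by omega) (by omega); omega
    · have := s1 (by omega) (by omega); omega
    · exact s3 (by omega) (by omega) (by omega)

lemma card_le_of_inj (S : Finset ℕ) (f : ℕ → ℤ) (c : ℤ) (R : ℕ)
    (hf : ∀ j ∈ S, c - R ≤ f j ∧ f j ≤ c + R)
    (hinj : ∀ j ∈ S, ∀ k ∈ S, j < k → f j ≠ f k) : S.card ≤ 2 * R + 1 := by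
  have : S.card ≤ (Finset.Icc (c - R) (c + R)).card := by
    apply Finset.card_le_card_of_injOn f
    · intro j hj; simpa using hf j hj
    · intro j hj k hk e
      by_contra hne
      rcases Nat.lt_or_gt_of_ne hne with h | h
      · exact hinj j hj k hk h e
      · exact hinj k hk j hj h e.symm
  rw [Int.card_Icc] at this
  omega

lemma count_bound (M : ℕ) (y v : ℕ → ℤ) (S : Finset ℕ)
    (hsep : ∀ j ∈ S, ∀ k ∈ S, j < k → SepProp M y v j k)
    (hy : ∀ j ∈ S, ∀ k ∈ S, y j - y k ≤ 2 * M) : S.card ≤ 3 * (4 * M + 1) := by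
  classical
  rcases S.eq_empty_or_nonempty with rfl | ⟨j0, hj0⟩
  · simp
  have c1 : (S.filter (fun j => (M:ℤ) < v j)).card ≤ 2 * (2 * M) + 1 := by
    apply card_le_of_inj _ y (y j0)
    · intro j hj
      have a := hy j (Finset.mem_filter.1 hj).1 j0 hj0
      have b := hy j0 hj0 j (Finset.mem_filter.1 hj).1
      push_cast
      constructor <;> linarith
    · intro j hj k hk hjk
      rw [Finset.mem_filter] at hj hk
      exact ((hsep j hj.1 k hk.1 hjk).1 hj.2 hk.2).ne'
  have c2 : (S.filter (fun j => v j < -(M:ℤ))).card ≤ 2 * (2 * M) + 1 := by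
    apply card_le_of_inj _ y (y j0)
    · intro j hj
      have a := hy j (Finset.mem_filter.1 hj).1 j0 hj0
      have b := hy j0 hj0 j (Finset.mem_filter.1 hj).1
      push_cast
      constructor <;> linarith
    · intro j hj k hk hjk
      rw [Finset.mem_filter] at hj hk
      exact ((hsep j hj.1 k hk.1 hjk).2.1 hj.2 hk.2).ne
  have c3 : (S.filter (fun j => -(M:ℤ) ≤ v j ∧ v j ≤ M)).card ≤ 2 * M + 1 := by
    apply card_le_of_inj _ v 0
    · intro j hj
      have := (Finset.mem_filter.1 hj).2
      omega
    · intro j hj k hk hjk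
      rw [Finset.mem_filter] at hj hk
      exact (hsep j hj.1 k hk.1 hjk).2.2 hj.2 hk.2
  have hcov : S ⊆ (S.filter (fun j => (M:ℤ) < v j)) ∪ ((S.filter (fun j => v j < -(M:ℤ))) ∪
      (S.filter (fun j => -(M:ℤ) ≤ v j ∧ v j ≤ M))) := by
    intro j hj
    simp only [Finset.mem_union, Finset.mem_filter, hj, true_and]
    omega
  have d1 := Finset.card_le_card hcov
  have d2 := Finset.card_union_le (S.filter (fun j => (M:ℤ) < v j))
    ((S.filter (fun j => v j < -(M:ℤ))) ∪ (S.filter (fun j => -(M:ℤ) ≤ v j ∧ v j ≤ M)))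
  have d3 := Finset.card_union_le (S.filter (fun j => v j < -(M:ℤ)))
    (S.filter (fun j => -(M:ℤ) ≤ v j ∧ v j ≤ M))
  omega

/-- Counting a set of bad times in a window. -/
lemma window_count (x g : ℕ → ℤ) (M : ℕ) (D : ℤ) (N : ℕ) (hM : 1 ≤ M) (h : Osc x g M D (N+9))
    (hD : 2 * M * N + 2 * M < D) (S : Finset ℕ) (hS : ∀ n ∈ S, n ≤ N)
    (hclose : ∀ n ∈ S, ∀ m ∈ S, n % 4 = m % 4 → x n - x m ≤ 2 * M) :
    S.card ≤ 4 * (3 * (4 * M + 1)) := by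
  classical
  have key : ∀ r < 4, (S.filter (fun n => n % 4 = r)).card ≤ 3 * (4 * M + 1) := by
    intro r hr
    have e : (S.filter (fun n => n % 4 = r)).card
        = ((S.filter (fun n => n % 4 = r)).image (fun n => n / 4)).card := by
      symm
      apply Finset.card_image_of_injOn
      intro a ha b hb hab
      simp only [Finset.coe_filter, Set.mem_ofPred_eq] at ha hb hab
      omega
    rw [e]
    have hmem : ∀ j ∈ (S.filter (fun n => n % 4 = r)).image (fun n => n / 4), 4 * j + r ∈ S := by
      intro j hj
      rw [Finset.mem_image] at hj
      obtain ⟨n, hn, rfl⟩ := hj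
      rw [Finset.mem_filter] at hn
      have : 4 * (n / 4) + r = n := by omega
      rw [this]; exact hn.1
    apply count_bound M (fun j => x (4 * j + r)) (fun j => x (4 * j + r + 1))
    · intro j hj k hk hjk
      have a := hS _ (hmem j hj)
      have b := hS _ (hmem k hk)
      refine sep M D _ _ (N / 4) (by exact_mod_cast hM) ?_ ?_ ?_ j k hjk (by omega)
      · intro i hi
        have := h.step (4 * i + r) (by omega)
        have e1 : 4 * (i + 1) + r = 4 * i + r + 4 := by ring
        simp only [e1]
        exact this
      · have : (((N / 4 : ℕ)) : ℤ) ≤ N := by exact_mod_cast Nat.div_le_self N 4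
        have : 2 * (M:ℤ) * ((N / 4 : ℕ) : ℤ) ≤ 2 * M * N := by
          apply mul_le_mul_of_nonneg_left this; positivity
        linarith
      · have := h.big r (by omega)
        simpa using this
    · intro j hj k hk
      exact hclose _ (hmem j hj) _ (hmem k hk) (by omega)
  have hcov : S.card = ∑ r ∈ Finset.range 4, (S.filter (fun n => n % 4 = r)).card := by
    apply Finset.card_eq_sum_card_fiberwise
    intro n hn
    simp only [Finset.coe_range, Set.mem_Iio]
    omega
  rw [hcov]
  calc _ ≤ ∑ r ∈ Finset.range 4, 3 * (4 * M + 1) :=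
        Finset.sum_le_sum (fun r hr => key r (Finset.mem_range.1 hr))
    _ = _ := by simp

/-- Crossing of the diagonal. -/
def Crossing (x : ℕ → ℤ) (n : ℕ) : Prop :=
  x (n+1) - x n < x (n+5) - x (n+4) ∧ x (n+5) - x (n+4) < 0 ∧
  0 ≤ x (n+9) - x (n+8) ∧ x (n+9) - x (n+8) < x (n+13) - x (n+12) ∧
  0 ≤ x (n+4) ∧ 0 ≤ x (n+5) ∧ 0 ≤ x (n+8) ∧ 0 ≤ x (n+9)

lemma start_exists (x g : ℕ → ℤ) (M D : ℤ) (N : ℕ) (hM : 1 ≤ M) (hD : 100 * M ≤ D)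
    (h : Osc x g M D N) (hN : 20 ≤ N) :
    ∃ n, 4 ≤ n ∧ n ≤ 8 ∧ x (n+1) < x n ∧ - x n - 4 * M ≤ x (n+1) := by
  have r4 := h.recur 4
  have r5 := h.recur 5
  have r6 := h.recur 6
  have r7 := h.recur 7
  have b5 := h.bdg 5 (by omega)
  have b6 := h.bdg 6 (by omega)
  have b7 := h.bdg 7 (by omega)
  have b8 := h.bdg 8 (by omega)
  have big := h.big 4 (by omega)
  norm_num at *
  by_contra hcon
  push Not at hcon
  have c4 := hcon 4 (by omega) (by omega)
  have c5 := hcon 5 (by omega) (by omega)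
  have c6 := hcon 6 (by omega) (by omega)
  have c7 := hcon 7 (by omega) (by omega)
  have c8 := hcon 8 (by omega) (by omega)
  norm_num at *
  have r8 := h.recur 8
  have b9 := h.bdg 9 (by omega)
  norm_num at *
  have big' : D ≤ x 4 ∨ D ≤ - x 4 ∨ D ≤ x 5 ∨ D ≤ - x 5 := by
    rcases big with h1 | h1 <;> rcases abs_cases (x 4) with h2 | h2 <;>
        rcases abs_cases (x 5) with h3 | h3 <;> omega
  omega

lemma crossing_aux (M D y0 v0 y1 v1 y2 v2 y3 v3 : ℤ) (hM : 1 ≤ M) (hD : 100 * M ≤ D)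
    (bg : D ≤ y1 ∨ D ≤ - y1 ∨ D ≤ v1 ∨ D ≤ - v1)
    (s : RotStep M y0 v0 y1 v1) (t : RotStep M y1 v1 y2 v2) (q : RotStep M y2 v2 y3 v3)
    (f1 : v1 < y1) (f2 : - y1 - 4 * M ≤ v1) (f3 : y2 ≤ v2) :
    v0 - y0 < v1 - y1 ∧ v1 - y1 < 0 ∧ 0 ≤ v2 - y2 ∧ v2 - y2 < v3 - y3 ∧
    0 ≤ y1 ∧ 0 ≤ v1 ∧ 0 ≤ y2 ∧ 0 ≤ v2 := by
  have s5 := s.h5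
  have s6 := s.h6
  have t5 := t.h5
  have t6 := t.h6
  have y1p : D - 4 * M ≤ y1 := by omega
  have v1p : D - 8 * M ≤ v1 := by omega
  have a1 := s.h1 (by omega)
  have a3 := s.h3 (by omega)
  have b1 := q.h1 (by omega)
  have b3 := q.h3 (by omega)
  refine ⟨?_, ?_, ?_, ?_, ?_, ?_, ?_, ?_⟩ <;> linarith

lemma crossing_exists (x g : ℕ → ℤ) (M D : ℤ) (N E : ℕ) (hM : 1 ≤ M) (hD : 100 * M ≤ D)
    (h : Osc x g M D N) (hE : ∀ n, n ≤ N → |x n| ≤ E) (hN : 8 * E + 40 ≤ N) :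
    ∃ n, n + 18 ≤ N ∧ Crossing x n := by
  classical
  obtain ⟨n0, h4, h8, hu, hs⟩ := start_exists x g M D N hM hD h (by omega)
  have bigd : ∀ n, n ≤ N → (D ≤ x n ∨ D ≤ - x n ∨ D ≤ x (n+1) ∨ D ≤ - x (n+1)) := by
    intro n hn
    rcases h.big n hn with h1 | h1 <;> rcases abs_cases (x n) with h2 | h2 <;>
        rcases abs_cases (x (n+1)) with h3 | h3 <;> omega
  -- existence of a crossing step
  have hex : ∃ j, j ≤ 2 * E + 1 ∧ x (n0 + 4 * j) ≤ x (n0 + 4 * j + 1) := by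
    by_contra hcon
    push Not at hcon
    have inv : ∀ j, j ≤ 2 * E + 1 → - x (n0 + 4 * j) - 4 * M ≤ x (n0 + 4 * j + 1) ∧
        x (n0+1) + j ≤ x (n0 + 4 * j + 1) := by
      intro j
      induction j with
      | zero => intro _; simpa using hs
      | succ j ih =>
        intro hj
        have i1 := ih (by omega)
        have i2 := hcon j (by omega)
        have st := h.step (n0 + 4 * j) (by omega)
        have bg := bigd (n0 + 4 * j) (by omega)
        have e1 : n0 + 4 * (j + 1) = n0 + 4 * j + 4 := by ring
        have e2 : n0 + 4 * j + 4 + 1 = n0 + 4 * j + 5 := by ring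
        rw [e1, e2]
        obtain ⟨s1, s2, s3, s4, s5, s6⟩ := st
        push_cast
        constructor <;> omega
    have a := (inv (2 * E + 1) le_rfl).2
    have b := hE (n0 + 4 * (2 * E + 1) + 1) (by omega)
    have c := hE (n0 + 1) (by omega)
    rw [abs_le] at b c
    push_cast at a
    omega
  obtain ⟨hj1, hj2⟩ := Nat.find_spec hex
  set j := Nat.find hex with hj
  have hj0 : j ≠ 0 := by
    intro e
    rw [e] at hj2
    simp at hj2; omega
  obtain ⟨i, hi⟩ := Nat.exists_eq_succ_of_ne_zero hj0
  have hlt : ∀ m, m ≤ i → x (n0 + 4 * m + 1) < x (n0 + 4 * m) := by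
    intro m hm
    have := Nat.find_min hex (m := m) (by omega)
    by_contra hh
    exact this ⟨by omega, by omega⟩
  have inv : ∀ m, m ≤ i → - x (n0 + 4 * m) - 4 * M ≤ x (n0 + 4 * m + 1) := by
    intro m
    induction m with
    | zero => intro _; simpa using hs
    | succ m ih =>
      intro hm
      have i1 := ih (by omega)
      have i2 := hlt m (by omega)
      obtain ⟨s1, s2, s3, s4, s5, s6⟩ := h.step (n0 + 4 * m) (by omega)
      have bg := bigd (n0 + 4 * m) (by omega)
      have e1 : n0 + 4 * (m + 1) = n0 + 4 * m + 4 := by ring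
      have e2 : n0 + 4 * m + 4 + 1 = n0 + 4 * m + 5 := by ring
      rw [e1, e2]
      omega
  have f1 := hlt i le_rfl
  have f2 := inv i le_rfl
  have e1 : n0 + 4 * j = n0 + 4 * i + 4 := by omega
  rw [e1] at hj2
  obtain ⟨n, hn⟩ : ∃ n, n0 + 4 * i = n + 4 := ⟨n0 + 4 * i - 4, by omega⟩
  rw [hn] at f1 f2 hj2
  refine ⟨n, by omega, ?_⟩
  exact crossing_aux M D (x n) (x (n+1)) (x (n+4)) (x (n+5)) (x (n+8)) (x (n+9)) (x (n+12))
    (x (n+13)) hM hD (bigd (n + 4) (by omega)) (h.step n (by omega)) (h.step (n + 4) (by omega))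
    (h.step (n + 8) (by omega)) f1 f2 hj2

/-! ### The function `P` -/

lemma Pfun_eq (x : ℝ) : Pfun x = (2*(⌊x⌋ : ℝ)+1) * x - ⌊x⌋ * (⌊x⌋ + 1) := by
  unfold Pfun; ring

lemma Pfun_ge (x : ℝ) (k : ℤ) : (2*(k : ℝ)+1) * x - k * (k + 1) ≤ Pfun x := by
  rw [Pfun_eq]
  have h1 := Int.floor_le x
  have h2 := Int.lt_floor_add_one x
  rcases lt_trichotomy ⌊x⌋ k with h | h | h
  · have h' : (⌊x⌋ : ℝ) + 1 ≤ k := by exact_mod_cast h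
    nlinarith
  · rw [h]
  · have h' : (k : ℝ) + 1 ≤ ⌊x⌋ := by exact_mod_cast h
    nlinarith

lemma Pfun_neg_ge (x : ℝ) : Pfun x ≤ Pfun (-x) := by
  have := Pfun_ge (-x) (-⌊x⌋ - 1)
  push_cast at this
  rw [Pfun_eq x]
  linarith

lemma Pfun_neg (x : ℝ) : Pfun (-x) = Pfun x := by
  apply le_antisymm
  · have := Pfun_neg_ge (-x); simpa using this
  · exact Pfun_neg_ge x

lemma abs_le_Pfun (x : ℝ) : |x| ≤ Pfun x := by
  rw [abs_le']
  constructor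
  · have := Pfun_ge x 0; norm_num at this; exact this
  · have := Pfun_ge x (-1); norm_num at this; linarith

lemma Pfun_small (x : ℝ) (h : |x| < 1) : Pfun x = |x| := by
  rw [abs_lt] at h
  rcases le_or_gt 0 x with h0 | h0
  · have : ⌊x⌋ = 0 := Int.floor_eq_iff.2 (by norm_num; exact ⟨h0, h.2⟩)
    rw [Pfun_eq, this, abs_of_nonneg h0]; norm_num
  · have : ⌊x⌋ = -1 := Int.floor_eq_iff.2 (by norm_num; exact ⟨by linarith, h0⟩)
    rw [Pfun_eq, this, abs_of_neg h0]; norm_num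

lemma Pfun_sub_ge (x y : ℝ) : (2*(⌊x⌋ : ℝ)+1) * (y - x) ≤ Pfun y - Pfun x := by
  have := Pfun_ge y ⌊x⌋
  rw [Pfun_eq x]; linarith

lemma Pfun_lip (x y K : ℝ) (hx : |(⌊x⌋ : ℝ)| ≤ K) (hy : |(⌊y⌋ : ℝ)| ≤ K) :
    |Pfun x - Pfun y| ≤ (2*K+1) * |x - y| := by
  have aux : ∀ a b : ℝ, |(⌊a⌋ : ℝ)| ≤ K → Pfun a - Pfun b ≤ (2*K+1) * |a - b| := by
    intro a b ha
    have h1 := Pfun_sub_ge a b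
    have h2 : |(2*(⌊a⌋ : ℝ)+1) * (a - b)| ≤ (2*K+1) * |a - b| := by
      rw [abs_mul]
      apply mul_le_mul_of_nonneg_right _ (abs_nonneg _)
      rw [abs_le] at ha ⊢
      constructor <;> linarith
    have h3 := le_abs_self ((2*(⌊a⌋ : ℝ)+1) * (a - b))
    linarith
  rw [abs_le']
  constructor
  · exact aux x y hx
  · have := aux y x hy
    rw [abs_sub_comm y x] at this
    linarith

lemma abs_floor_le (x B : ℝ) (h : |x| ≤ B) : |(⌊x⌋ : ℝ)| ≤ B + 1 := by
  have h1 := Int.floor_le x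
  have h2 := Int.lt_floor_add_one x
  rw [abs_le] at h ⊢
  constructor <;> linarith

/-! ### Scalar orbits -/

/-- Scalar orbit of the discretised rotation. -/
def IsSeq (lam : ℝ) (x : ℕ → ℤ) : Prop := ∀ n, x (n+2) = ⌊lam * x (n+1)⌋ - x n

/-- The Hamiltonian along a scalar orbit. -/
noncomputable def Hs (lam : ℝ) (x : ℕ → ℤ) (n : ℕ) : ℝ :=
  Pfun (lam * x (n+1)) + Pfun (lam * x n)

lemma Hs_bound0 (lam : ℝ) (x : ℕ → ℤ) (n : ℕ) (B : ℝ) (h : Hs lam x n ≤ B) :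
    |lam * x n| ≤ B ∧ |lam * x (n+1)| ≤ B := by
  unfold Hs at h
  have h1 := abs_le_Pfun (lam * x (n+1))
  have h2 := abs_le_Pfun (lam * x n)
  have h3 := abs_nonneg (lam * x (n+1))
  have h4 := abs_nonneg (lam * x n)
  constructor <;> linarith

lemma osc_of_Hs (lam : ℝ) (hl : 0 < lam) (x : ℕ → ℤ) (hx : IsSeq lam x) (h B : ℝ)
    (M : ℕ) (hM : B + 1 ≤ M) (D : ℤ) (hD1 : D * lam < 1) (hD : D * lam < h / 2) (N : ℕ)
    (hH : ∀ n, n ≤ N → h ≤ Hs lam x n ∧ Hs lam x n ≤ B) :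
    Osc x (fun n => ⌊lam * x n⌋) M D N := by
  refine ⟨fun n => ?_, fun n hn => ?_, fun n hn => ?_, fun n hn => ?_, fun n hn => ?_⟩
  · have := hx n; omega
  · apply Int.floor_nonneg.2
    have : (0:ℝ) ≤ x n := by exact_mod_cast hn
    positivity
  · have h1 : (x n : ℝ) < 0 := by exact_mod_cast hn
    have h2 : lam * x n < 0 := by nlinarith
    have : ⌊lam * x n⌋ < 0 := Int.floor_lt.2 (by simpa using h2)
    omega
  · have h1 := abs_floor_le _ _ (Hs_bound0 lam x n B (hH n hn).2).1
    have h2 : |(⌊lam * x n⌋ : ℝ)| ≤ M := h1.trans hM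
    rw [abs_le] at h2
    constructor
    · exact_mod_cast h2.1
    · exact_mod_cast h2.2
  · by_contra hcon
    push Not at hcon
    have key : ∀ z : ℤ, |z| < D → |lam * z| < 1 ∧ |lam * z| < h / 2 := by
      intro z hz
      have hz' : |(z : ℝ)| < D := by exact_mod_cast hz
      have : |lam * z| < D * lam := by
        rw [abs_mul, abs_of_pos hl]; nlinarith
      constructor <;> linarith
    have k1 := key _ hcon.1
    have k2 := key _ hcon.2
    have := (hH n hn).1
    unfold Hs at this
    rw [Pfun_small _ k1.1, Pfun_small _ k2.1] at this
    linarith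

/-- One step variation of the Hamiltonian. -/
lemma Hs_step (lam : ℝ) (hl : 0 < lam) (x : ℕ → ℤ) (hx : IsSeq lam x) (B : ℝ) (M : ℕ)
    (hM : B + 2 ≤ M) (hlM : lam * M ≤ 1) (n : ℕ) (hB : Hs lam x n ≤ B) :
    |Hs lam x (n+1) - Hs lam x n| ≤ (2*M+1)*M*lam := by
  obtain ⟨b0, b1⟩ := Hs_bound0 lam x n B hB
  have f1 := abs_floor_le _ _ b1
  have f1' : |(⌊lam * x (n+1)⌋ : ℝ)| ≤ M := f1.trans (by linarith)
  have e : Hs lam x (n+1) - Hs lam x n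
      = Pfun (lam * x n - lam * ⌊lam * x (n+1)⌋) - Pfun (lam * x n) := by
    unfold Hs
    have e1 : (x (n+1+1) : ℝ) = ⌊lam * x (n+1)⌋ - x n := by
      have := hx n
      rw [show n + 1 + 1 = n + 2 by ring, this]; push_cast; ring
    rw [e1, ← Pfun_neg (lam * x n - lam * ⌊lam * x (n+1)⌋)]
    ring_nf
  rw [e]
  have g1 : |lam * (⌊lam * x (n+1)⌋ : ℝ)| ≤ lam * M := by
    rw [abs_mul, abs_of_pos hl]; gcongr
  have g2 : |lam * x n - lam * ⌊lam * x (n+1)⌋| ≤ B + 1 := by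
    have := abs_sub (lam * x n) (lam * ⌊lam * x (n+1)⌋)
    linarith
  have l1 := Pfun_lip (lam * x n - lam * ⌊lam * x (n+1)⌋) (lam * x n) M
    ((abs_floor_le _ _ g2).trans (by linarith)) ((abs_floor_le _ _ b0).trans (by linarith))
  have e2 : |lam * x n - lam * ⌊lam * x (n+1)⌋ - lam * x n| = |lam * (⌊lam * x (n+1)⌋ : ℝ)| := by
    rw [← abs_neg]; congr 1; ring
  rw [e2] at l1
  calc _ ≤ _ := l1
    _ ≤ (2*M+1) * (lam * M) := by gcongr
    _ = _ := by ring

/-- Corrected Hamiltonian. -/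
noncomputable def Qs (lam : ℝ) (x : ℕ → ℤ) (n : ℕ) : ℝ :=
  Hs lam x n - lam * ⌊lam * x (n+1)⌋ * ⌊lam * x n⌋

/-- Regular steps. -/
def Reg (lam : ℝ) (x : ℕ → ℤ) (n : ℕ) : Prop :=
  ⌊lam * x (n+2)⌋ = - ⌊lam * x n⌋ - 1

lemma Qs_step_reg (lam : ℝ) (x : ℕ → ℤ) (hx : IsSeq lam x) (n : ℕ) (h : Reg lam x n) :
    Qs lam x (n+1) = Qs lam x n := by
  unfold Reg at h
  have e1 : (x (n+2) : ℝ) = ⌊lam * x (n+1)⌋ - x n := by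
    rw [hx n]; push_cast; ring
  unfold Qs Hs
  rw [show n + 1 + 1 = n + 2 by ring, Pfun_eq (lam * x (n+2)), Pfun_eq (lam * x n), h, e1]
  push_cast
  ring

lemma near_of_not_reg (lam : ℝ) (hl : 0 < lam) (x : ℕ → ℤ) (hx : IsSeq lam x) (n M : ℕ)
    (hM : |(⌊lam * x (n+1)⌋ : ℝ)| ≤ M) (h : ¬ Reg lam x n) :
    ∃ c : ℤ, |lam * x n - c| ≤ lam * M := by
  have e1 : (x (n+2) : ℝ) = ⌊lam * x (n+1)⌋ - x n := by
    rw [hx n]; push_cast; ring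
  have g1 : |lam * (⌊lam * x (n+1)⌋ : ℝ)| ≤ lam * M := by
    rw [abs_mul, abs_of_pos hl]; gcongr
  rw [abs_le] at g1
  unfold Reg at h
  rw [Int.floor_eq_iff, e1] at h
  push_cast at h
  have h1 := Int.floor_le (lam * x n)
  have h2 := Int.lt_floor_add_one (lam * x n)
  by_cases hc : lam * x n - lam * ⌊lam * x (n+1)⌋ ≤ ⌊lam * x n⌋
  · refine ⟨⌊lam * x n⌋, ?_⟩
    rw [abs_le]; constructor <;> linarith
  · refine ⟨⌊lam * x n⌋ + 1, ?_⟩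
    push Not at hc
    have hd : lam * x n - lam * ⌊lam * x (n+1)⌋ > ⌊lam * x n⌋ + 1 := by
      by_contra hcon
      push Not at hcon
      apply h
      constructor <;> linarith
    push_cast
    rw [abs_le]; constructor <;> linarith

lemma telescope (f : ℕ → ℝ) (bad : ℕ → Prop) [DecidablePred bad] (K : ℝ) (N : ℕ)
    (h1 : ∀ n, n < N → ¬ bad n → f (n+1) = f n) (h2 : ∀ n, n < N → |f (n+1) - f n| ≤ K) :
    |f N - f 0| ≤ K * ((Finset.range N).filter bad).card := by
  induction N with
  | zero => simp
  | succ N ih =>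
    have i := ih (fun n hn => h1 n (by omega)) (fun n hn => h2 n (by omega))
    rw [Finset.range_add_one, Finset.filter_insert]
    split_ifs with hb
    · rw [Finset.card_insert_of_notMem (by simp)]
      have a := h2 N (by omega)
      have b := abs_add_le (f (N+1) - f N) (f N - f 0)
      rw [show f (N+1) - f N + (f N - f 0) = f (N+1) - f 0 by ring] at b
      push_cast
      linarith
    · rw [h1 N (by omega) hb]; exact i

lemma dist_mod4 (x g : ℕ → ℤ) (M : ℕ) (D : ℤ) (N : ℕ) (h : Osc x g M D (N+9)) (n m : ℕ)
    (hn : n ≤ N) (hm : m ≤ N) (e : n % 4 = m % 4) : |x n - x m| ≤ 2 * M * N := by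
  wlog hnm : n ≤ m with H
  · rw [abs_sub_comm]
    exact H x g M D N h m n hm hn e.symm (by omega)
  obtain ⟨i, hi⟩ : ∃ i, m = n + 4 * i := ⟨(m - n) / 4, by omega⟩
  subst hi
  have := dist_of_step (fun j => x (n + 4 * j)) (2 * M) i (fun j hj => by
    have := (h.step (n + 4 * j) (by omega)).h5
    rw [show n + 4 * (j + 1) = n + 4 * j + 4 by ring]
    exact this)
  simp only [mul_zero, add_zero] at this
  have hiN : (i : ℤ) ≤ N := by omega
  have : 2 * (M:ℤ) * i ≤ 2 * M * N := by gcongr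
  rw [abs_le]
  constructor <;> linarith

/-- Short windows. -/
lemma window (h B : ℝ) (hh : 0 < h) (hhB : h ≤ B) : ∃ ε > (0:ℝ), ∃ C > (0:ℝ), ∃ l0 > (0:ℝ),
    ∀ lam : ℝ, 0 < lam → lam < l0 → ∀ x : ℕ → ℤ, IsSeq lam x → h ≤ Hs lam x 0 → Hs lam x 0 ≤ B →
      ∀ n : ℕ, n * lam ≤ ε → |Hs lam x n - Hs lam x 0| ≤ C * lam := by
  classical
  obtain ⟨M, hM⟩ := exists_nat_ge (2 * B + 2)
  have hM1 : (1:ℝ) ≤ M := by linarith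
  have hM1' : 1 ≤ M := by exact_mod_cast hM1
  set C1 : ℝ := (2*M+1)*M with hC1
  have hC1p : 0 < C1 := by positivity
  set δ : ℝ := min (1/2) (h/8) with hδ
  have hδ0 : 0 < δ := by positivity
  have hδ1 : δ ≤ 1/2 := min_le_left _ _
  have hδ2 : δ ≤ h/8 := min_le_right _ _
  set ε : ℝ := min (h/(4*C1)) (δ/(4*M)) with hε
  have hε0 : 0 < ε := by positivity
  have hε1 : C1 * (2 * ε) ≤ h / 2 := by
    have : ε ≤ h/(4*C1) := min_le_left _ _
    rw [le_div_iff₀ (by positivity)] at this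
    linarith
  have hε2 : 2 * M * ε ≤ δ / 2 := by
    have : ε ≤ δ/(4*M) := min_le_right _ _
    rw [le_div_iff₀ (by positivity)] at this
    linarith
  set K : ℝ := C1 + 2 * M^2 with hK
  refine ⟨ε, hε0, 2 * M^2 + K * (4 * (3 * (4 * M + 1)) : ℕ), by positivity,
    min (ε / 10) (δ / (2 * (2*M+1))), by positivity, ?_⟩
  intro lam hl hl0 x hx hh0 hB0 N hN
  have l1 : 10 * lam ≤ ε := by
    have := hl0.trans_le (min_le_left _ _)
    linarith
  have l2 : (2 * M + 1) * lam < δ / 2 := by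
    have := hl0.trans_le (min_le_right _ _)
    rw [lt_div_iff₀ (by positivity)] at this
    linarith
  have lM : lam * M ≤ 1 := by nlinarith
  -- a priori bounds
  have apriori : ∀ n : ℕ, n * lam ≤ 2 * ε → |Hs lam x n - Hs lam x 0| ≤ C1 * (n * lam) := by
    intro n
    induction n with
    | zero => intro _; simp
    | succ n ih =>
      intro hn
      push_cast at hn
      have i := ih (by linarith)
      have i2 : C1 * (n * lam) ≤ C1 * (2 * ε) := by
        apply mul_le_mul_of_nonneg_left _ hC1p.le; linarith
      have i3 := (abs_le.1 i).2
      have s := Hs_step lam hl x hx (2*B) M (by linarith) lM n (by linarith)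
      have t := abs_add_le (Hs lam x (n+1) - Hs lam x n) (Hs lam x n - Hs lam x 0)
      rw [show Hs lam x (n+1) - Hs lam x n + (Hs lam x n - Hs lam x 0)
        = Hs lam x (n+1) - Hs lam x 0 by ring] at t
      push_cast
      rw [← hC1] at s
      linarith
  have bds : ∀ n : ℕ, n ≤ N + 9 → h / 2 ≤ Hs lam x n ∧ Hs lam x n ≤ 2 * B := by
    intro n hn
    have hn' : (n : ℝ) ≤ N + 9 := by exact_mod_cast hn
    have hn2 : n * lam ≤ 2 * ε := by nlinarith
    have i := apriori n hn2
    have i2 : C1 * (n * lam) ≤ C1 * (2 * ε) := by gcongr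
    rw [abs_le] at i
    constructor <;> linarith
  have fl : ∀ n : ℕ, n ≤ N + 10 → |(⌊lam * x n⌋ : ℝ)| ≤ M := by
    intro n hn
    rcases Nat.lt_or_ge n (N+10) with h1 | h1
    · exact (abs_floor_le _ _ (Hs_bound0 lam x n _ (bds n (by omega)).2).1).trans (by linarith)
    · have : n = N + 9 + 1 := by omega
      subst this
      exact (abs_floor_le _ _ (Hs_bound0 lam x (N+9) _ (bds _ (by omega)).2).2).trans (by linarith)
  set D : ℤ := ⌊δ / lam⌋ with hD
  have D1 : D * lam ≤ δ := by
    have := Int.floor_le (δ / lam)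
    rwa [le_div_iff₀ hl] at this
  have D2 : δ < (D + 1) * lam := by
    have := Int.lt_floor_add_one (δ / lam)
    rwa [div_lt_iff₀ hl] at this
  have osc := osc_of_Hs lam hl x hx (h/2) (2*B) M (by linarith) D (by linarith) (by linarith)
    (N+9) bds
  have cnt := window_count x _ M D N hM1' osc (by
      have : ((2 * M * N + 2 * M : ℤ) : ℝ) < D := by
        push_cast
        have : (2 * M * N + 2 * M : ℝ) * lam < D * lam := by nlinarith
        exact lt_of_mul_lt_mul_right this hl.le
      exact_mod_cast this)
    ((Finset.range N).filter (fun n => ¬ Reg lam x n))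
    (fun n hn => by
      rw [Finset.mem_filter, Finset.mem_range] at hn; omega)
    (fun n hn m hm e => by
      rw [Finset.mem_filter, Finset.mem_range] at hn hm
      obtain ⟨c, hc⟩ := near_of_not_reg lam hl x hx n M (fl _ (by omega)) hn.2
      obtain ⟨d, hd⟩ := near_of_not_reg lam hl x hx m M (fl _ (by omega)) hm.2
      have ds := dist_mod4 x _ M D N osc n m (by omega) (by omega) e
      have ds' : |(x n : ℝ) - x m| ≤ 2 * M * N := by exact_mod_cast ds
      have ds2 : |lam * x n - lam * x m| ≤ 1/4 := by
        rw [← mul_sub, abs_mul, abs_of_pos hl]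
        have : lam * |(x n : ℝ) - x m| ≤ lam * (2 * M * N) := by gcongr
        have : 2 * M * (N * lam) ≤ 2 * M * ε := by gcongr
        linarith
      have hcd : c = d := by
        have : |(c : ℝ) - d| < 1 := by
          rw [abs_le] at hc hd ds2
          rw [abs_lt]
          constructor <;> linarith
        have : |c - d| < 1 := by exact_mod_cast this
        rw [Int.abs_lt_one_iff] at this
        omega
      subst hcd
      have : lam * ((x n : ℝ) - x m) ≤ lam * (2 * M) := by
        rw [abs_le] at hc hd; linarith
      have := le_of_mul_le_mul_left this hl
      exact_mod_cast this)
  have QH : ∀ n, n ≤ N → |Qs lam x n - Hs lam x n| ≤ M^2 * lam := by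
    intro n hn
    unfold Qs
    rw [show Hs lam x n - lam * ⌊lam * x (n+1)⌋ * ⌊lam * x n⌋ - Hs lam x n
      = -(lam * (⌊lam * x (n+1)⌋ * ⌊lam * x n⌋)) by ring, abs_neg, abs_mul, abs_mul,
      abs_of_pos hl]
    have a := fl n (by omega)
    have b := fl (n+1) (by omega)
    calc lam * (|(⌊lam * x (n+1)⌋ : ℝ)| * |(⌊lam * x n⌋ : ℝ)|) ≤ lam * (M * M) := by gcongr
      _ = _ := by ring
  have tel := telescope (Qs lam x) (fun n => ¬ Reg lam x n) (K * lam) N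
    (fun n hn hr => Qs_step_reg lam x hx n (not_not.1 hr))
    (fun n hn => by
      have a := QH n (by omega)
      have b := QH (n+1) (by omega)
      have s := Hs_step lam hl x hx (2*B) M (by linarith) lM n (bds n (by omega)).2
      rw [← hC1] at s
      rw [abs_le] at a b s ⊢
      rw [hK]
      constructor <;> linarith)
  have cnt' : ((((Finset.range N).filter (fun n => ¬ Reg lam x n)).card : ℕ) : ℝ)
      ≤ (4 * (3 * (4 * M + 1)) : ℕ) := by exact_mod_cast cnt
  have fin : |Qs lam x N - Qs lam x 0| ≤ (K * lam) * (4 * (3 * (4 * M + 1)) : ℕ) := by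
    refine tel.trans ?_
    have : 0 ≤ K * lam := by positivity
    exact mul_le_mul_of_nonneg_left cnt' this
  have a := QH N le_rfl
  have b := QH 0 (by omega)
  rw [abs_le] at a b fin ⊢
  constructor <;> linarith

lemma IsSeq.shift {lam : ℝ} {x : ℕ → ℤ} (hx : IsSeq lam x) (m : ℕ) :
    IsSeq lam (fun n => x (m + n)) := fun n => hx (m + n)

/-- Long times, by concatenation of windows. -/
lemma long_time (h0 C0 K : ℝ) (hh : 0 < h0) (hC0 : 0 ≤ C0) : ∃ C > (0:ℝ), ∃ l0 > (0:ℝ),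
    ∀ lam : ℝ, 0 < lam → lam < l0 → ∀ x : ℕ → ℤ, IsSeq lam x → |Hs lam x 0 - h0| ≤ C0 * lam →
      ∀ n : ℕ, n * lam ≤ K → |Hs lam x n - h0| ≤ C * lam := by
  obtain ⟨ε, hε, C, hC, l1, hl1, hw⟩ := window (h0/2) (2*h0) (by linarith) (by linarith)
  have ind : ∀ i : ℕ, ∃ l0 > (0:ℝ), ∀ lam : ℝ, 0 < lam → lam < l0 → ∀ x : ℕ → ℤ, IsSeq lam x →
      |Hs lam x 0 - h0| ≤ C0 * lam →
      ∀ n : ℕ, n * lam ≤ i * (ε/2) → |Hs lam x n - h0| ≤ (C0 + i * C) * lam := by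
    intro i
    induction i with
    | zero =>
      refine ⟨1, one_pos, fun lam hl _ x hx h n hn => ?_⟩
      have : n = 0 := by
        by_contra hne
        have : (0:ℝ) < n := by exact_mod_cast Nat.pos_of_ne_zero hne
        have : 0 < n * lam := by positivity
        simp at hn; linarith
      subst this
      simpa using h
    | succ i ih =>
      obtain ⟨l2, hl2, ih⟩ := ih
      refine ⟨min (min l1 l2) (min (ε/2) (h0 / (2 * (C0 + i * C + 1)))), by positivity, ?_⟩
      intro lam hl hlt x hx h n hn
      simp only [lt_min_iff] at hlt
      obtain ⟨⟨a1, a2⟩, a3, a4⟩ := hlt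
      have a5 : (C0 + i * C) * lam ≤ h0 / 2 := by
        rw [lt_div_iff₀ (by positivity)] at a4
        linarith
      have hCi : 0 ≤ (i:ℝ) * C := by positivity
      by_cases hc : n * lam ≤ i * (ε/2)
      · have := ih lam hl a2 x hx h n hc
        push_cast
        have : 0 ≤ C * lam := by positivity
        linarith
      · push Not at hc
        set m := ⌊i * (ε/2) / lam⌋₊ with hm
        have m1 : m * lam ≤ i * (ε/2) := by
          have := Nat.floor_le (a := i * (ε/2) / lam) (by positivity)
          rwa [le_div_iff₀ hl] at this
        have m2 : i * (ε/2) < (m + 1) * lam := by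
          have := Nat.lt_floor_add_one (i * (ε/2) / lam)
          rwa [div_lt_iff₀ hl] at this
        have hmn : m ≤ n := by
          have : (m : ℝ) * lam < n * lam := by linarith
          have : (m : ℝ) < n := lt_of_mul_lt_mul_right this hl.le
          exact_mod_cast this.le
        obtain ⟨k, rfl⟩ := Nat.exists_eq_add_of_le hmn
        have b := ih lam hl a2 x hx h m m1
        have b' := abs_le.1 b
        push_cast at hn ⊢
        have c := hw lam hl a1 (fun j => x (m + j)) (hx.shift m)
          (by change h0 / 2 ≤ Hs lam x m; linarith) (by change Hs lam x m ≤ _; linarith) k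
          (by linarith)
        change |Hs lam x (m + k) - Hs lam x m| ≤ C * lam at c
        have t := abs_add_le (Hs lam x (m+k) - Hs lam x m) (Hs lam x m - h0)
        rw [show Hs lam x (m+k) - Hs lam x m + (Hs lam x m - h0) = Hs lam x (m+k) - h0 by ring] at t
        linarith
  obtain ⟨i, hi⟩ := exists_nat_ge (K / (ε/2))
  rw [div_le_iff₀ (by positivity)] at hi
  obtain ⟨l0, hl0, H⟩ := ind i
  refine ⟨C0 + i * C + 1, by positivity, l0, hl0, fun lam hl hlt x hx h n hn => ?_⟩
  have := H lam hl hlt x hx h n (by linarith)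
  linarith

/-- The forward statement: a crossing occurs, with control up to it. -/
lemma forward (h0 C0 : ℝ) (hh : 0 < h0) (hC0 : 0 ≤ C0) : ∃ C > (0:ℝ), ∃ l0 > (0:ℝ),
    ∀ lam : ℝ, 0 < lam → lam < l0 → ∀ x : ℕ → ℤ, IsSeq lam x → |Hs lam x 0 - h0| ≤ C0 * lam →
      ∃ n, Crossing x n ∧ ∀ k, k ≤ n + 8 → |Hs lam x k - h0| ≤ C * lam := by
  obtain ⟨C, hC, l1, hl1, H⟩ := long_time h0 C0 (16 * h0 + 42) hh hC0
  obtain ⟨M, hM⟩ := exists_nat_ge (2 * h0 + 1)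
  have hM1 : (1:ℝ) ≤ M := by linarith
  set δ : ℝ := min (1/2) (h0/8) with hδ
  have hδ0 : 0 < δ := by positivity
  have hδ1 : δ ≤ 1/2 := min_le_left _ _
  have hδ2 : δ ≤ h0/8 := min_le_right _ _
  refine ⟨C, hC, min (min l1 1) (min (h0 / (2 * C)) (δ / (100 * M + 1))), by positivity, ?_⟩
  intro lam hl hlt x hx h
  simp only [lt_min_iff] at hlt
  obtain ⟨⟨a1, a2⟩, a3, a4⟩ := hlt
  rw [lt_div_iff₀ (by positivity)] at a3 a4
  have Hn := H lam hl a1 x hx h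
  set E := ⌊2 * h0 / lam⌋₊ with hE
  have E1 : E * lam ≤ 2 * h0 := by
    have := Nat.floor_le (a := 2 * h0 / lam) (by positivity)
    rwa [le_div_iff₀ hl] at this
  have ctl : ∀ n, n ≤ 8 * E + 40 → |Hs lam x n - h0| ≤ C * lam := by
    intro n hn
    apply Hn
    have : (n : ℝ) ≤ 8 * E + 40 := by exact_mod_cast hn
    nlinarith
  have bds : ∀ n, n ≤ 8 * E + 40 → h0 / 2 ≤ Hs lam x n ∧ Hs lam x n ≤ 2 * h0 := by
    intro n hn
    have := abs_le.1 (ctl n hn)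
    constructor <;> linarith
  set D : ℤ := ⌊δ / lam⌋ with hD
  have D1 : D * lam ≤ δ := by
    have := Int.floor_le (δ / lam)
    rwa [le_div_iff₀ hl] at this
  have osc := osc_of_Hs lam hl x hx (h0/2) (2*h0) M (by linarith) D (by linarith) (by linarith)
    (8 * E + 40) bds
  obtain ⟨n, hn1, hn2⟩ := crossing_exists x _ M D (8 * E + 40) E (by exact_mod_cast hM1)
    (by
      rw [hD, Int.le_floor, le_div_iff₀ hl]
      push_cast
      linarith) osc
    (fun n hn => by
      have b := (Hs_bound0 lam x n _ (bds n hn).2).1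
      rw [abs_mul, abs_of_pos hl] at b
      have : ((|x n|.toNat : ℕ) : ℝ) = |(x n : ℝ)| := by
        have : ((|x n|.toNat : ℕ) : ℤ) = |x n| := Int.toNat_of_nonneg (abs_nonneg _)
        rw [← Int.cast_abs]; exact_mod_cast congrArg (Int.cast : ℤ → ℝ) this
      have : |x n|.toNat ≤ E := by
        rw [hE]
        apply Nat.le_floor
        rw [this, le_div_iff₀ hl]; linarith
      omega) le_rfl
  exact ⟨n, hn2, fun k hk => ctl k (by omega)⟩

/-! ### Orbits of `Fe` -/

/-- The scalar orbit associated to a lattice point. -/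
noncomputable def xs (lam : ℝ) (p : ℤ × ℤ) (n : ℕ) : ℤ := ((Fe lam ^ n) p).2

lemma Fe_apply (lam : ℝ) (p : ℤ × ℤ) : Fe lam p = (⌊lam * p.1⌋ - p.2, p.1) := rfl

lemma Fe_pow_succ (lam : ℝ) (p : ℤ × ℤ) (n : ℕ) :
    (Fe lam ^ (n+1)) p = Fe lam ((Fe lam ^ n) p) := by
  rw [pow_succ', Equiv.Perm.mul_apply]

lemma Fe_pow_eq (lam : ℝ) (p : ℤ × ℤ) (n : ℕ) :
    (Fe lam ^ n) p = (xs lam p (n+1), xs lam p n) := by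
  unfold xs
  rw [Fe_pow_succ, Fe_apply]

lemma xs_isSeq (lam : ℝ) (p : ℤ × ℤ) : IsSeq lam (xs lam p) := by
  intro n
  have h := Fe_pow_eq lam p (n+1)
  rw [Fe_pow_succ, Fe_apply, Fe_pow_eq lam p n] at h
  exact (congrArg Prod.fst h).symm

lemma Hs_xs (lam : ℝ) (p : ℤ × ℤ) (n : ℕ) :
    Hs lam (xs lam p) n = ham (pt lam ((Fe lam ^ n) p)) := by
  rw [Fe_pow_eq]; rfl

lemma Fe_inv_swap (lam : ℝ) (p : ℤ × ℤ) : (Fe lam)⁻¹ p = (Fe lam p.swap).swap := rfl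

lemma Fe_neg_pow (lam : ℝ) (p : ℤ × ℤ) (n : ℕ) :
    (Fe lam ^ (-(n:ℤ))) p = ((Fe lam ^ n) p.swap).swap := by
  induction n with
  | zero => simp
  | succ n ih =>
    rw [Fe_pow_succ, show (-((n+1 : ℕ):ℤ)) = -1 + -(n:ℤ) by push_cast; ring, zpow_add,
      Equiv.Perm.mul_apply, ih, zpow_neg_one, Fe_inv_swap, Prod.swap_swap]

lemma ham_swap (lam : ℝ) (p : ℤ × ℤ) : ham (pt lam p.swap) = ham (pt lam p) := by
  unfold ham pt; simp only [Prod.fst_swap, Prod.snd_swap]; ring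

lemma dline_eq (lam : ℝ) (hl : 0 < lam) (p : ℤ × ℤ) :
    dline (pt lam p) = (lam / Real.sqrt 2) * ((|p.1 - p.2| : ℤ) : ℝ) := by
  unfold dline pt
  simp only
  rw [← mul_sub, abs_mul, abs_of_pos hl]
  push_cast; ring

lemma mem_Xset (lam : ℝ) (hl : 0 < lam) (p : ℤ × ℤ) (h1 : 0 ≤ p.1) (h2 : 0 ≤ p.2) (a b : ℤ × ℤ)
    (ha : (Fe lam ^ 4) p = a) (hb : (Fe lam ^ (-4 : ℤ)) p = b)
    (h3 : |p.1 - p.2| ≤ |a.1 - a.2|) (h4 : |p.1 - p.2| < |b.1 - b.2|) : p ∈ Xset lam := by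
  refine ⟨h1, h2, ?_, ?_⟩
  · rw [ha, dline_eq lam hl, dline_eq lam hl]
    have : ((|p.1 - p.2| : ℤ) : ℝ) ≤ ((|a.1 - a.2| : ℤ) : ℝ) := by exact_mod_cast h3
    gcongr
  · rw [hb, dline_eq lam hl, dline_eq lam hl]
    have : ((|p.1 - p.2| : ℤ) : ℝ) < ((|b.1 - b.2| : ℤ) : ℝ) := by exact_mod_cast h4
    gcongr

lemma Fe4_zpow (lam : ℝ) (p : ℤ × ℤ) (k : ℤ) :
    (Fe lam ^ 4) ((Fe lam ^ k) p) = (Fe lam ^ (k + 4)) p := by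
  rw [show k + 4 = ((4:ℕ):ℤ) + k by push_cast; ring, zpow_add, Equiv.Perm.mul_apply, zpow_natCast]

lemma Fem4_zpow (lam : ℝ) (p : ℤ × ℤ) (k : ℤ) :
    (Fe lam ^ (-4:ℤ)) ((Fe lam ^ k) p) = (Fe lam ^ (k - 4)) p := by
  rw [show k - 4 = -4 + k by ring, zpow_add, Equiv.Perm.mul_apply]

lemma Fe_zpow_nat (lam : ℝ) (p : ℤ × ℤ) (n : ℕ) :
    (Fe lam ^ (n:ℤ)) p = (xs lam p (n+1), xs lam p n) := by
  rw [zpow_natCast, Fe_pow_eq]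

lemma Fe_zpow_neg (lam : ℝ) (p : ℤ × ℤ) (n : ℕ) :
    (Fe lam ^ (-(n:ℤ))) p = (xs lam p.swap n, xs lam p.swap (n+1)) := by
  rw [Fe_neg_pow, Fe_pow_eq]; rfl

lemma mem_X_fwd (lam : ℝ) (hl : 0 < lam) (p : ℤ × ℤ) (k : ℕ)
    (h1 : 0 ≤ xs lam p (k+5)) (h2 : 0 ≤ xs lam p (k+4))
    (h3 : |xs lam p (k+5) - xs lam p (k+4)| ≤ |xs lam p (k+9) - xs lam p (k+8)|)
    (h4 : |xs lam p (k+5) - xs lam p (k+4)| < |xs lam p (k+1) - xs lam p k|) :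
    (Fe lam ^ (((k+4 : ℕ)):ℤ)) p ∈ Xset lam := by
  refine mem_Xset lam hl _ ?_ ?_ (xs lam p (k+9), xs lam p (k+8)) (xs lam p (k+1), xs lam p k)
    ?_ ?_ ?_ ?_
  · rw [Fe_zpow_nat]; exact h1
  · rw [Fe_zpow_nat]; exact h2
  · rw [Fe4_zpow, show (((k+4 : ℕ)):ℤ) + 4 = ((k+8 : ℕ) : ℤ) by push_cast; ring, Fe_zpow_nat]
  · rw [Fem4_zpow, show (((k+4 : ℕ)):ℤ) - 4 = ((k : ℕ) : ℤ) by push_cast; ring, Fe_zpow_nat]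
  · rw [Fe_zpow_nat]; exact h3
  · rw [Fe_zpow_nat]; exact h4

lemma mem_X_bwd (lam : ℝ) (hl : 0 < lam) (p : ℤ × ℤ) (k : ℕ)
    (h1 : 0 ≤ xs lam p.swap (k+5)) (h2 : 0 ≤ xs lam p.swap (k+4))
    (h3 : |xs lam p.swap (k+5) - xs lam p.swap (k+4)| ≤ |xs lam p.swap (k+1) - xs lam p.swap k|)
    (h4 : |xs lam p.swap (k+5) - xs lam p.swap (k+4)|
      < |xs lam p.swap (k+9) - xs lam p.swap (k+8)|) :
    (Fe lam ^ (-((k+4 : ℕ):ℤ))) p ∈ Xset lam := by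
  refine mem_Xset lam hl _ ?_ ?_ (xs lam p.swap k, xs lam p.swap (k+1))
    (xs lam p.swap (k+8), xs lam p.swap (k+9)) ?_ ?_ ?_ ?_
  · rw [Fe_zpow_neg]; exact h2
  · rw [Fe_zpow_neg]; exact h1
  · rw [Fe4_zpow, show -(((k+4 : ℕ)):ℤ) + 4 = -((k : ℕ) : ℤ) by push_cast; ring, Fe_zpow_neg]
  · rw [Fem4_zpow, show -(((k+4 : ℕ)):ℤ) - 4 = -((k+8 : ℕ) : ℤ) by push_cast; ring, Fe_zpow_neg]
  · rw [Fe_zpow_neg, abs_sub_comm, abs_sub_comm (xs lam p.swap k)]; exact h3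
  · rw [Fe_zpow_neg, abs_sub_comm, abs_sub_comm (xs lam p.swap (k+8))]; exact h4

lemma tauPlus_le (lam : ℝ) (hl : 0 < lam) (p : ℤ × ℤ) (n : ℕ) (h : Crossing (xs lam p) n) :
    tauPlus lam p ≤ n + 8 := by
  obtain ⟨c1, c2, c3, c4, c5, c6, c7, c8⟩ := h
  unfold tauPlus
  rcases le_or_gt |xs lam p (n+5) - xs lam p (n+4)| |xs lam p (n+9) - xs lam p (n+8)| with h | h
  · refine (Nat.sInf_le (m := n + 4) (show _ ∧ _ from ⟨by omega, ?_⟩)).trans (by omega)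
    refine mem_X_fwd lam hl p n c6 c5 h ?_
    rw [abs_of_neg c2, abs_of_neg (c1.trans c2)]; omega
  · refine (Nat.sInf_le (m := n + 4 + 4) (show _ ∧ _ from ⟨by omega, ?_⟩))
    refine mem_X_fwd lam hl p (n+4) c8 c7 ?_ h
    change |xs lam p (n+9) - xs lam p (n+8)| ≤ |xs lam p (n+13) - xs lam p (n+12)|
    rw [abs_of_nonneg c3, abs_of_nonneg (c3.trans c4.le)]; omega

lemma tauMinus_le (lam : ℝ) (hl : 0 < lam) (p : ℤ × ℤ) (n : ℕ)
    (h : Crossing (xs lam p.swap) n) : tauMinus lam p ≤ n + 8 := by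
  obtain ⟨c1, c2, c3, c4, c5, c6, c7, c8⟩ := h
  unfold tauMinus
  rcases lt_or_ge |xs lam p.swap (n+5) - xs lam p.swap (n+4)|
    |xs lam p.swap (n+9) - xs lam p.swap (n+8)| with h | h
  · refine (Nat.sInf_le (m := n + 4) ?_).trans (by omega)
    refine mem_X_bwd lam hl p n c6 c5 ?_ h
    rw [abs_of_neg c2, abs_of_neg (c1.trans c2)]; omega
  · refine (Nat.sInf_le (m := n + 4 + 4) ?_)
    refine mem_X_bwd lam hl p (n+4) c8 c7 h ?_
    change |xs lam p.swap (n+9) - xs lam p.swap (n+8)|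
      < |xs lam p.swap (n+13) - xs lam p.swap (n+12)|
    rw [abs_of_nonneg c3, abs_of_nonneg (c3.trans c4.le)]; omega

lemma ham_pos (w : ℝ × ℝ) (hw : w ≠ 0) : 0 < ham w := by
  unfold ham
  have h1 := abs_le_Pfun w.1
  have h2 := abs_le_Pfun w.2
  have h3 := abs_nonneg w.1
  have h4 := abs_nonneg w.2
  by_contra hcon
  push Not at hcon
  apply hw
  have e1 : |w.1| = 0 := by linarith
  have e2 : |w.2| = 0 := by linarith
  exact Prod.ext (abs_eq_zero.1 e1) (abs_eq_zero.1 e2)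

lemma Pfun_round (lam : ℝ) (hl : 0 < lam) (hl1 : lam < 1) (t : ℝ) :
    |Pfun (lam * ⌊t / lam⌋) - Pfun t| ≤ (2 * (|t| + 2) + 1) * lam := by
  have h1 : lam * ⌊t / lam⌋ ≤ t := by
    have := Int.floor_le (t / lam)
    rw [le_div_iff₀ hl] at this; linarith
  have h2 : t < lam * ⌊t / lam⌋ + lam := by
    have := Int.lt_floor_add_one (t / lam)
    rw [div_lt_iff₀ hl] at this; linarith
  have h3 : |lam * ⌊t / lam⌋ - t| ≤ lam := by
    rw [abs_le]; constructor <;> linarith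
  have h4 : |lam * ⌊t / lam⌋| ≤ |t| + 1 := by
    have := abs_add_le (lam * ⌊t / lam⌋ - t) t
    rw [sub_add_cancel] at this; linarith
  refine (Pfun_lip _ _ (|t| + 2) ?_ ?_).trans ?_
  · have := abs_floor_le _ _ h4; linarith
  · have := abs_floor_le t _ le_rfl; linarith
  · gcongr

/-- For every `w ∈ ℝ²`, `w ≠ 0`, there are `C > 0` and `λ₀ > 0` such that for all
`0 < λ < λ₀` and every point `ξ` of the return orbit of `R_λ(w)`, one has
`|𝒫(ξ) − 𝒫(w)| ≤ C·λ`. -/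
theorem ham_variation_along_return_orbit (w : ℝ × ℝ) (hw : w ≠ 0) :
    ∃ C > (0:ℝ), ∃ lam0 > (0:ℝ), ∀ lam : ℝ, 0 < lam → lam < lam0 →
      ∀ q ∈ retOrbit lam (Rlam lam w), |ham (pt lam q) - ham w| ≤ C * lam := by
  have hh := ham_pos w hw
  set C0 : ℝ := (2 * (|w.1| + 2) + 1) + (2 * (|w.2| + 2) + 1) with hC0
  obtain ⟨C, hC, l0, hl0, H⟩ := forward (ham w) C0 hh (by positivity)
  refine ⟨C, hC, min l0 1, by positivity, fun lam hl hlt q hq => ?_⟩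
  rw [lt_min_iff] at hlt
  have init : |ham (pt lam (Rlam lam w)) - ham w| ≤ C0 * lam := by
    have a := Pfun_round lam hl hlt.2 w.1
    have b := Pfun_round lam hl hlt.2 w.2
    unfold ham pt Rlam
    simp only
    rw [abs_le] at a b ⊢
    rw [hC0]
    constructor <;> linarith
  generalize Rlam lam w = p at hq init
  obtain ⟨k, hk1, hk2, rfl⟩ := hq
  rcases le_or_gt 0 k with hk | hk
  · obtain ⟨n, hn1, hn2⟩ := H lam hl hlt.1 (xs lam p) (xs_isSeq lam p) (by
      rw [Hs_xs]; simpa using init)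
    have ht := tauPlus_le lam hl p n hn1
    obtain ⟨m, rfl⟩ := Int.eq_ofNat_of_zero_le hk
    have := hn2 m (by omega)
    rw [Hs_xs] at this
    rw [zpow_natCast]; exact this
  · obtain ⟨n, hn1, hn2⟩ := H lam hl hlt.1 (xs lam p.swap) (xs_isSeq lam p.swap) (by
      rw [Hs_xs]; simpa [ham_swap] using init)
    have ht := tauMinus_le lam hl p n hn1
    obtain ⟨m, hm⟩ := Int.eq_ofNat_of_zero_le (a := -k) (by omega)
    obtain rfl : k = -(m:ℤ) := by omega
    have := hn2 m (by omega)
    rw [Hs_xs] at this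
    rw [Fe_neg_pow, ham_swap]; exact this
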